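/- In dimension 2, the Poincaré operators for the strain elasticity complex satisfy: p₁(def u) = u − j(u) where j(u)(x) = u(0) + (1/2)(curl uᵀ)(0) x^R is a rigid motion; p₂(sven v) + def(p₁ v) = v; and sven(p₂ w) = w. -/

import Mathlib

open Matrix MeasureTheory

noncomputable section

/-- Points of the plane. -/
abbrev V2 := Fin 2 → ℝ
/-- 2×2 real matrices. -/
abbrev M2 := Matrix (Fin 2) (Fin 2) ℝ

/-- Partial derivative `∂ᵢ` of a scalar field. -/
noncomputable def pd (i : Fin 2) (f : V2 → ℝ) : V2 → ℝ :=
  fun x => fderiv ℝ f x (Pi.single i 1)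

/-- The vector `x` rotated by `π/2`: `x^R = (-x₂, x₁)`. -/
def xR (x : V2) : V2 := ![-(x 1), x 0]

/-- The Airy operator of a scalar field. -/
noncomputable def airyOp (u : V2 → ℝ) : V2 → M2 := fun x =>
  !![pd 1 (pd 1 u) x, -(pd 1 (pd 0 u) x); -(pd 0 (pd 1 u) x), pd 0 (pd 0 u) x]

/-- The Hessian of a scalar field. -/
noncomputable def hessOp (u : V2 → ℝ) : V2 → M2 := fun x =>
  Matrix.of fun i j => pd i (pd j u) x

/-- Row-wise divergence of a matrix field. -/
noncomputable def matDiv (u : V2 → M2) : V2 → V2 := fun x =>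
  ![pd 0 (fun y => u y 0 0) x + pd 1 (fun y => u y 0 1) x,
    pd 0 (fun y => u y 1 0) x + pd 1 (fun y => u y 1 1) x]

/-- Row-wise curl of a matrix field (one scalar per row). -/
noncomputable def matCurl (u : V2 → M2) : V2 → V2 := fun x =>
  ![pd 0 (fun y => u y 0 1) x - pd 1 (fun y => u y 0 0) x,
    pd 0 (fun y => u y 1 1) x - pd 1 (fun y => u y 1 0) x]

/-- Deformation (symmetric gradient) of a vector field. -/
noncomputable def defoOp (u : V2 → V2) : V2 → M2 := fun x =>
  Matrix.of fun i j => (pd j (fun y => u y i) x + pd i (fun y => u y j) x) / 2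

/-- The Saint-Venant operator of a matrix field:
`∂₂₂u₁₁ + ∂₁₁u₂₂ − ∂₁₂u₂₁ − ∂₂₁u₁₂`. -/
noncomputable def svenOp (u : V2 → M2) : V2 → ℝ := fun x =>
  pd 1 (pd 1 (fun y => u y 0 0)) x + pd 0 (pd 0 (fun y => u y 1 1)) x
    - pd 0 (pd 1 (fun y => u y 1 0)) x - pd 1 (pd 0 (fun y => u y 0 1)) x

/-- Symmetric part of a matrix. -/
def symM (m : M2) : M2 := (2⁻¹ : ℝ) • (m + m.transpose)

/-- Row-wise curl of a (column) vector field, producing a matrix whose `i`-th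
row is `curl vᵢ = (∂₂vᵢ, −∂₁vᵢ)`. -/
noncomputable def curlRows (v : V2 → V2) : V2 → M2 := fun x =>
  !![pd 1 (fun y => v y 0) x, -(pd 0 (fun y => v y 0) x);
     pd 1 (fun y => v y 1) x, -(pd 0 (fun y => v y 1) x)]

/-- Poincaré operator `p₁` for the stress complex. -/
noncomputable def p1s (u : V2 → M2) : V2 → ℝ := fun x =>
  ∫ t in (0:ℝ)..1, (1 - t) * (xR x ⬝ᵥ (u (t • x)).mulVec (xR x))

/-- Poincaré operator `p₂` for the stress complex. -/
noncomputable def p2s (u : V2 → V2) : V2 → M2 := fun x =>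
  symM (Matrix.of fun i j => ∫ t in (0:ℝ)..1, t * (u (t • x) i * x j))
  + symM (curlRows (fun y =>
      (∫ t in (0:ℝ)..1, (t * (1 - t)) * (xR y ⬝ᵥ u (t • y))) • y) x)

/-- Poincaré operator `p₁` for the strain complex. -/
noncomputable def p1e (u : V2 → M2) : V2 → V2 := fun x i =>
  (∫ t in (0:ℝ)..1, ((u (t • x)).transpose.mulVec x) i)
  + ∫ t in (0:ℝ)..1, (1 - t) * ((matCurl u (t • x) ⬝ᵥ x) * xR x i)

/-- Poincaré operator `p₂` for the strain complex. -/
noncomputable def p2e (u : V2 → ℝ) : V2 → M2 := fun x =>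
  (∫ t in (0:ℝ)..1, t * (1 - t) * u (t • x)) • Matrix.vecMulVec (xR x) (xR x)

/-- Rotation by `π/2`. -/
def J2 : M2 := !![0, -1; 1, 0]

/-- The operator `K m = mᵀ − tr(m)·I₂`. -/
def KOp (m : M2) : M2 := m.transpose - (Matrix.trace m) • 1

/-- Weighted radial moments. -/
def Mom (n : ℕ) (f : V2 → ℝ) : V2 → ℝ := fun x => ∫ t in (0:ℝ)..1, t ^ n * f (t • x)

/-- `f` has gradient `(a, b)` at `x`. -/
def HD (f : V2 → ℝ) (a b : ℝ) (x : V2) : Prop :=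
  HasFDerivAt f (a • (ContinuousLinearMap.proj 0 : V2 →L[ℝ] ℝ)
    + b • (ContinuousLinearMap.proj 1 : V2 →L[ℝ] ℝ)) x

lemma HD.pd0 {f : V2 → ℝ} {a b : ℝ} {x : V2} (h : HD f a b x) : pd 0 f x = a := by
  have h' : HasFDerivAt f _ x := h
  simp [pd, h'.fderiv]

lemma HD.pd1 {f : V2 → ℝ} {a b : ℝ} {x : V2} (h : HD f a b x) : pd 1 f x = b := by
  have h' : HasFDerivAt f _ x := h
  simp [pd, h'.fderiv]

lemma clm_eq (L : V2 →L[ℝ] ℝ) : L = (L (Pi.single 0 1)) • (ContinuousLinearMap.proj 0 : V2 →L[ℝ] ℝ)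
    + (L (Pi.single 1 1)) • (ContinuousLinearMap.proj 1 : V2 →L[ℝ] ℝ) := by
  refine ContinuousLinearMap.ext fun y => ?_
  have hy : y = y 0 • Pi.single 0 1 + y 1 • Pi.single 1 1 := by
    ext i; fin_cases i <;> simp
  conv_lhs => rw [hy]
  simp only [map_add, map_smul]
  simp [mul_comm]

lemma HD.of_diff {f : V2 → ℝ} {x : V2} (h : DifferentiableAt ℝ f x) :
    HD f (pd 0 f x) (pd 1 f x) x := by
  unfold HD pd
  rw [← clm_eq]
  exact h.hasFDerivAt

lemma HD.add {f g : V2 → ℝ} {a b c d : ℝ} {x : V2} (h : HD f a b x) (k : HD g c d x) :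
    HD (fun y => f y + g y) (a + c) (b + d) x := by
  unfold HD at *
  refine (HasFDerivAt.add h k).congr_fderiv ?_
  module

lemma HD.sub {f g : V2 → ℝ} {a b c d : ℝ} {x : V2} (h : HD f a b x) (k : HD g c d x) :
    HD (fun y => f y - g y) (a - c) (b - d) x := by
  unfold HD at *
  refine (HasFDerivAt.sub h k).congr_fderiv ?_
  module

lemma HD.neg {f : V2 → ℝ} {a b : ℝ} {x : V2} (h : HD f a b x) :
    HD (fun y => - f y) (-a) (-b) x := by
  unfold HD at *
  refine (HasFDerivAt.neg h).congr_fderiv ?_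
  module

lemma HD.mul {f g : V2 → ℝ} {a b c d : ℝ} {x : V2} (h : HD f a b x) (k : HD g c d x) :
    HD (fun y => f y * g y) (a * g x + f x * c) (b * g x + f x * d) x := by
  unfold HD at *
  refine (HasFDerivAt.mul h k).congr_fderiv ?_
  module

lemma HD.const (c : ℝ) (x : V2) : HD (fun _ => c) 0 0 x := by
  unfold HD
  refine (hasFDerivAt_const c x).congr_fderiv ?_
  module

lemma HD.div {f : V2 → ℝ} {a b : ℝ} {x : V2} (h : HD f a b x) (c : ℝ) :
    HD (fun y => f y / c) (a / c) (b / c) x := by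
  have := h.mul (HD.const c⁻¹ x)
  simpa [div_eq_mul_inv] using this

lemma HD.c0 (x : V2) : HD (fun y => y 0) 1 0 x := by
  unfold HD
  refine ((ContinuousLinearMap.proj 0 : V2 →L[ℝ] ℝ).hasFDerivAt).congr_fderiv ?_
  module

lemma HD.c1 (x : V2) : HD (fun y => y 1) 0 1 x := by
  unfold HD
  refine ((ContinuousLinearMap.proj 1 : V2 →L[ℝ] ℝ).hasFDerivAt).congr_fderiv ?_
  module

lemma HD.congr {U : Set V2} (hU : IsOpen U) {f g : V2 → ℝ} {a b : ℝ} {x : V2} (hx : x ∈ U)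
    (h : HD f a b x) (hfg : ∀ y ∈ U, g y = f y) : HD g a b x := by
  unfold HD at *
  refine HasFDerivAt.congr_of_eventuallyEq h ?_
  filter_upwards [hU.mem_nhds hx] with y hy using hfg y hy

/-- Smooth on `U`. -/
abbrev Sm (U : Set V2) (f : V2 → ℝ) : Prop := ContDiffOn ℝ (⊤ : ℕ∞) f U

lemma Sm.diff {U : Set V2} (hU : IsOpen U) {f : V2 → ℝ} (hf : Sm U f) {x : V2} (hx : x ∈ U) :
    DifferentiableAt ℝ f x :=
  (hf.differentiableOn (by simp)).differentiableAt (hU.mem_nhds hx)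

lemma Sm.hd {U : Set V2} (hU : IsOpen U) {f : V2 → ℝ} (hf : Sm U f) {x : V2} (hx : x ∈ U) :
    HD f (pd 0 f x) (pd 1 f x) x := HD.of_diff (hf.diff hU hx)

lemma Sm.fd {U : Set V2} (hU : IsOpen U) {f : V2 → ℝ} (hf : Sm U f) :
    ContDiffOn ℝ (⊤ : ℕ∞) (fderiv ℝ f) U :=
  hf.fderiv_of_isOpen hU (by simp)

lemma Sm.pd {U : Set V2} (hU : IsOpen U) {f : V2 → ℝ} (hf : Sm U f) (i : Fin 2) :
    Sm U (pd i f) :=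
  (hf.fd hU).clm_apply contDiffOn_const

lemma Sm.symm {U : Set V2} (hU : IsOpen U) {f : V2 → ℝ} (hf : Sm U f) {x : V2} (hx : x ∈ U) :
    _root_.pd 0 (_root_.pd 1 f) x = _root_.pd 1 (_root_.pd 0 f) x := by
  have h := (hf.contDiffAt (hU.mem_nhds hx)).isSymmSndFDerivAt (by
    simp only [minSmoothness_of_isRCLikeNormedField]; exact WithTop.coe_le_coe.2 (le_top : (2 : ℕ∞) ≤ ⊤))
  have hd : DifferentiableAt ℝ (fderiv ℝ f) x :=
    ((hf.fd hU).differentiableOn (by simp)).differentiableAt (hU.mem_nhds hx)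
  have key : ∀ i j : Fin 2, _root_.pd i (_root_.pd j f) x
      = fderiv ℝ (fderiv ℝ f) x (Pi.single i 1) (Pi.single j 1) := by
    intro i j
    have := (hd.hasFDerivAt.clm_apply (hasFDerivAt_const (Pi.single j 1 : V2) x)).fderiv
    unfold _root_.pd
    rw [this]
    simp
  rw [key, key]
  exact h _ _

/-- Star-shaped with respect to `0`. -/
abbrev StarU (U : Set V2) : Prop := ∀ x ∈ U, ∀ t ∈ Set.Icc (0:ℝ) 1, t • x ∈ U

lemma ray_cont {U : Set V2} (hs : StarU U) {E : Type*} [TopologicalSpace E] {f : V2 → E}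
    (hf : ContinuousOn f U) {x : V2}
    (hx : x ∈ U) : ContinuousOn (fun t : ℝ => f (t • x)) (Set.Icc 0 1) :=
  hf.comp (by fun_prop) (fun t ht => hs x hx t ht)

lemma ray_int {U : Set V2} (hs : StarU U) {f : V2 → ℝ}
    (hf : ContinuousOn f U) {x : V2} (hx : x ∈ U) {φ : ℝ → ℝ} (hφ : Continuous φ) :
    IntervalIntegrable (fun t : ℝ => φ t * f (t • x)) volume 0 1 := by
  apply ContinuousOn.intervalIntegrable
  rw [Set.uIcc_of_le zero_le_one]
  exact hφ.continuousOn.mul (ray_cont hs hf hx)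

lemma Mom_congr {U : Set V2} (hs : StarU U) {f g : V2 → ℝ} (h : ∀ y ∈ U, f y = g y) (n : ℕ)
    {x : V2} (hx : x ∈ U) : Mom n f x = Mom n g x := by
  unfold Mom
  apply intervalIntegral.integral_congr
  intro t ht
  rw [Set.uIcc_of_le zero_le_one] at ht
  simp only [h _ (hs x hx t ht)]

lemma Mom_add {U : Set V2} (hs : StarU U) {f g : V2 → ℝ} (hf : Sm U f) (hg : Sm U g) (n : ℕ)
    {x : V2} (hx : x ∈ U) : Mom n (fun y => f y + g y) x = Mom n f x + Mom n g x := by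
  unfold Mom
  rw [← intervalIntegral.integral_add (ray_int hs hf.continuousOn hx (by fun_prop))
    (ray_int hs hg.continuousOn hx (by fun_prop))]
  simp only [mul_add]

lemma Mom_sub {U : Set V2} (hs : StarU U) {f g : V2 → ℝ} (hf : Sm U f) (hg : Sm U g) (n : ℕ)
    {x : V2} (hx : x ∈ U) : Mom n (fun y => f y - g y) x = Mom n f x - Mom n g x := by
  unfold Mom
  rw [← intervalIntegral.integral_sub (ray_int hs hf.continuousOn hx (by fun_prop))
    (ray_int hs hg.continuousOn hx (by fun_prop))]
  simp only [mul_sub]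

lemma Mom_div (f : V2 → ℝ) (n : ℕ) (c : ℝ) (x : V2) :
    Mom n (fun y => f y / c) x = Mom n f x / c := by
  unfold Mom
  rw [← intervalIntegral.integral_div]
  simp only [mul_div_assoc]

lemma ray_deriv {U : Set V2} (hU : IsOpen U) (hs : StarU U) {f : V2 → ℝ} (hf : Sm U f)
    {x : V2} (hx : x ∈ U) {t : ℝ} (ht : t ∈ Set.Icc (0:ℝ) 1) :
    HasDerivAt (fun s : ℝ => f (s • x)) (x 0 * pd 0 f (t • x) + x 1 * pd 1 f (t • x)) t := by
  have h1 : HasFDerivAt f _ (t • x) := hf.hd hU (hs x hx t ht)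
  have h2 : HasDerivAt (fun s : ℝ => s • x) x t := by
    simpa using (hasDerivAt_id t).smul_const x
  have := h1.comp_hasDerivAt t h2
  refine this.congr_deriv ?_
  simp [mul_comm]

lemma euler {U : Set V2} (hU : IsOpen U) (hs : StarU U) {f : V2 → ℝ} (hf : Sm U f) (n : ℕ)
    {x : V2} (hx : x ∈ U) :
    x 0 * Mom n (pd 0 f) x + x 1 * Mom n (pd 1 f) x
      = f x - 0 ^ n * f 0 - n * Mom (n - 1) f x := by
  have key := intervalIntegral.integral_mul_deriv_eq_deriv_mul (a := 0) (b := 1)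
    (u := fun t : ℝ => t ^ n) (u' := fun t : ℝ => n * t ^ (n - 1))
    (v := fun t : ℝ => f (t • x))
    (v' := fun t => x 0 * pd 0 f (t • x) + x 1 * pd 1 f (t • x))
    (fun t _ => hasDerivAt_pow n t)
    (fun t ht => ray_deriv hU hs hf hx (by rwa [Set.uIcc_of_le zero_le_one] at ht))
    (by apply Continuous.intervalIntegrable; fun_prop)
    ((ray_int hs (hf.pd hU 0).continuousOn hx (φ := fun _ => x 0) (by fun_prop)).add
      (ray_int hs (hf.pd hU 1).continuousOn hx (φ := fun _ => x 1) (by fun_prop)))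
  simp only [one_smul, zero_smul, one_pow, one_mul, mul_assoc] at key
  rw [intervalIntegral.integral_const_mul] at key
  unfold Mom
  rw [← key, ← intervalIntegral.integral_const_mul, ← intervalIntegral.integral_const_mul,
    ← intervalIntegral.integral_add]
  · congr 1; ext t; ring
  · exact (ray_int hs (hf.pd hU 0).continuousOn hx (by fun_prop)).const_mul _
  · exact (ray_int hs (hf.pd hU 1).continuousOn hx (by fun_prop)).const_mul _

lemma Mom_hd {U : Set V2} (hU : IsOpen U) (hs : StarU U) {f : V2 → ℝ} (hf : Sm U f) (n : ℕ)
    {x : V2} (hx : x ∈ U) :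
    HD (Mom n f) (Mom (n + 1) (pd 0 f) x) (Mom (n + 1) (pd 1 f) x) x := by
  obtain ⟨ε, hε, hb⟩ := Metric.nhds_basis_closedBall.mem_iff.1 (hU.mem_nhds hx)
  have hfd : ContinuousOn (fderiv ℝ f) U := (hf.fd hU).continuousOn
  set K : Set V2 := (fun p : ℝ × V2 => p.1 • p.2) '' (Set.Icc (0:ℝ) 1 ×ˢ Metric.closedBall x ε)
  have hK : IsCompact K :=
    (isCompact_Icc.prod (isCompact_closedBall x ε)).image (by fun_prop)
  have hKU : K ⊆ U := by
    rintro _ ⟨⟨t, y⟩, ⟨ht, hy⟩, rfl⟩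
    exact hs y (hb hy) t ht
  obtain ⟨C, hC⟩ := hK.exists_bound_of_continuousOn (hfd.mono hKU)
  have hIoc : ∀ t : ℝ, t ∈ Set.uIoc (0:ℝ) 1 → t ∈ Set.Icc (0:ℝ) 1 := by
    intro t ht
    rw [Set.uIoc_of_le zero_le_one] at ht
    exact ⟨ht.1.le, ht.2⟩
  have hcont' : ContinuousOn (fun t : ℝ => (t ^ (n+1)) • fderiv ℝ f (t • x)) (Set.Icc 0 1) :=
    (by fun_prop : Continuous fun t : ℝ => t ^ (n+1)).continuousOn.smul (ray_cont hs hfd hx)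
  have hint' : IntervalIntegrable (fun t : ℝ => (t ^ (n+1)) • fderiv ℝ f (t • x)) volume 0 1 := by
    apply ContinuousOn.intervalIntegrable
    rwa [Set.uIcc_of_le zero_le_one]
  have main := intervalIntegral.hasFDerivAt_integral_of_dominated_of_fderiv_le (𝕜 := ℝ)
    (μ := volume) (a := 0) (b := 1)
    (F := fun y (t : ℝ) => t ^ n * f (t • y))
    (F' := fun y t => (t ^ (n+1)) • fderiv ℝ f (t • y)) (x₀ := x) (bound := fun _ => C)
    (Metric.closedBall_mem_nhds x hε)
    (by
      filter_upwards [hU.mem_nhds hx] with y hy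
      exact (intervalIntegrable_iff.1
        (ray_int hs hf.continuousOn hy (by fun_prop))).aestronglyMeasurable)
    (ray_int hs hf.continuousOn hx (by fun_prop))
    (intervalIntegrable_iff.1 hint').aestronglyMeasurable
    (by
      refine Filter.Eventually.of_forall fun t ht y hy => ?_
      have ht' := hIoc t ht
      have h1 := hC (t • y) ⟨(t, y), ⟨ht', hy⟩, rfl⟩
      rw [norm_smul, Real.norm_of_nonneg (pow_nonneg ht'.1 _)]
      calc t ^ (n+1) * ‖fderiv ℝ f (t • y)‖ ≤ 1 * ‖fderiv ℝ f (t • y)‖ := by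
            gcongr
            exact pow_le_one₀ ht'.1 ht'.2
        _ ≤ C := by rwa [one_mul])
    (by simp)
    (by
      refine Filter.Eventually.of_forall fun t ht y hy => ?_
      have hd := (hf.diff hU (hs y (hb hy) t (hIoc t ht))).hasFDerivAt
      have h2 : HasFDerivAt (fun z : V2 => t • z) (t • ContinuousLinearMap.id ℝ V2) y :=
        (hasFDerivAt_id y).const_smul t
      refine ((hd.comp y h2).const_mul (t ^ n)).congr_fderiv ?_
      ext z
      simp
      ring)
  unfold HD
  have main' : HasFDerivAt (Mom n f) _ x := main
  refine main'.congr_fderiv ?_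
  rw [clm_eq (∫ t in (0:ℝ)..1, (t ^ (n+1)) • fderiv ℝ f (t • x)),
    ContinuousLinearMap.intervalIntegral_apply hint',
    ContinuousLinearMap.intervalIntegral_apply hint']
  rfl

lemma int1 {U : Set V2} (hs : StarU U) {f g : V2 → ℝ} (hf : Sm U f) (hg : Sm U g)
    {x : V2} (hx : x ∈ U) (a b : ℝ) :
    ∫ t in (0:ℝ)..1, (f (t • x) * a + g (t • x) * b) = a * Mom 0 f x + b * Mom 0 g x := by
  unfold Mom
  rw [← intervalIntegral.integral_const_mul, ← intervalIntegral.integral_const_mul,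
    ← intervalIntegral.integral_add]
  · congr 1; ext t; ring
  · exact (ray_int hs hf.continuousOn hx (by fun_prop)).const_mul _
  · exact (ray_int hs hg.continuousOn hx (by fun_prop)).const_mul _

lemma int2 {U : Set V2} (hs : StarU U) {f : V2 → ℝ} (hf : Sm U f)
    {x : V2} (hx : x ∈ U) :
    ∫ t in (0:ℝ)..1, (1 - t) * f (t • x) = Mom 0 f x - Mom 1 f x := by
  unfold Mom
  rw [← intervalIntegral.integral_sub (ray_int hs hf.continuousOn hx (by fun_prop))
    (ray_int hs hf.continuousOn hx (by fun_prop))]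
  congr 1; ext t; ring

lemma int3 {U : Set V2} (hs : StarU U) {f : V2 → ℝ} (hf : Sm U f)
    {x : V2} (hx : x ∈ U) :
    ∫ t in (0:ℝ)..1, t * (1 - t) * f (t • x) = Mom 1 f x - Mom 2 f x := by
  unfold Mom
  rw [← intervalIntegral.integral_sub (ray_int hs hf.continuousOn hx (by fun_prop))
    (ray_int hs hf.continuousOn hx (by fun_prop))]
  congr 1; ext t; ring

lemma p1e_eq {U : Set V2} (hs : StarU U) {v : V2 → M2} (hv : ∀ i j, Sm U (fun y => v y i j))
    {c0 c1 : V2 → ℝ} (hc0 : Sm U c0) (hc1 : Sm U c1)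
    (h0 : ∀ y ∈ U, matCurl v y 0 = c0 y) (h1 : ∀ y ∈ U, matCurl v y 1 = c1 y)
    {x : V2} (hx : x ∈ U) (i : Fin 2) :
    p1e v x i = x 0 * Mom 0 (fun y => v y 0 i) x + x 1 * Mom 0 (fun y => v y 1 i) x
      + (x 0 * (Mom 0 c0 x - Mom 1 c0 x) + x 1 * (Mom 0 c1 x - Mom 1 c1 x)) * xR x i := by
  unfold p1e
  congr 1
  · rw [← int1 hs (hv 0 i) (hv 1 i) hx]
    congr 1
    ext t
    simp [Matrix.mulVec, dotProduct, Fin.sum_univ_two]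
  · rw [← int2 hs hc0 hx, ← int2 hs hc1 hx, ← intervalIntegral.integral_const_mul,
      ← intervalIntegral.integral_const_mul, ← intervalIntegral.integral_add,
      ← intervalIntegral.integral_mul_const]
    · apply intervalIntegral.integral_congr
      intro t ht
      rw [Set.uIcc_of_le zero_le_one] at ht
      have := hs x hx t ht
      simp only [dotProduct, Fin.sum_univ_two, h0 _ this, h1 _ this]
      ring
    · exact (ray_int hs hc0.continuousOn hx (by fun_prop)).const_mul _
    · exact (ray_int hs hc1.continuousOn hx (by fun_prop)).const_mul _

lemma part1 {U : Set V2} (hU : IsOpen U) (hs : StarU U) {u : V2 → V2} {A B : V2 → ℝ}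
    (eA : (fun y => u y 0) = A) (eB : (fun y => u y 1) = B)
    (hA : Sm U A) (hB : Sm U B) {x : V2} (hx : x ∈ U) :
    p1e (defoOp u) x
      = u x - (u 0 + ((pd 0 (fun y => u y 1) 0 - pd 1 (fun y => u y 0) 0) / 2) • xR x) := by
  have e00 : (fun y => defoOp u y 0 0) = fun y => (pd 0 A y + pd 0 A y) / 2 := by
    simp [defoOp, eA]
  have e01 : (fun y => defoOp u y 0 1) = fun y => (pd 1 A y + pd 0 B y) / 2 := by
    simp [defoOp, eA, eB]
  have e10 : (fun y => defoOp u y 1 0) = fun y => (pd 0 B y + pd 1 A y) / 2 := by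
    simp [defoOp, eA, eB]
  have e11 : (fun y => defoOp u y 1 1) = fun y => (pd 1 B y + pd 1 B y) / 2 := by
    simp [defoOp, eB]
  have hA0 := hA.pd hU 0
  have hA1 := hA.pd hU 1
  have hB0 := hB.pd hU 0
  have hB1 := hB.pd hU 1
  have hω : Sm U (fun y => (pd 0 B y - pd 1 A y) / 2) := (hB0.sub hA1).div_const 2
  have he : ∀ i j, Sm U (fun y => defoOp u y i j) := by
    intro i j
    fin_cases i <;> fin_cases j
    · exact e00 ▸ (hA0.add hA0).div_const 2
    · exact e01 ▸ (hA1.add hB0).div_const 2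
    · exact e10 ▸ (hB0.add hA1).div_const 2
    · exact e11 ▸ (hB1.add hB1).div_const 2
  set ω : V2 → ℝ := fun y => (pd 0 B y - pd 1 A y) / 2 with hωd
  have hc0 : ∀ y ∈ U, matCurl (defoOp u) y 0 = pd 0 ω y := by
    intro y hy
    simp only [matCurl, e00, e01, Matrix.cons_val_zero]
    rw [(((hA1.hd hU hy).add (hB0.hd hU hy)).div 2).pd0,
      (((hA0.hd hU hy).add (hA0.hd hU hy)).div 2).pd1,
      (((hB0.hd hU hy).sub (hA1.hd hU hy)).div 2).pd0, hA.symm hU hy]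
    ring
  have hc1 : ∀ y ∈ U, matCurl (defoOp u) y 1 = pd 1 ω y := by
    intro y hy
    simp only [matCurl, e10, e11, Matrix.cons_val_one, Matrix.cons_val_zero]
    rw [(((hB1.hd hU hy).add (hB1.hd hU hy)).div 2).pd0,
      (((hB0.hd hU hy).add (hA1.hd hU hy)).div 2).pd1,
      (((hB0.hd hU hy).sub (hA1.hd hU hy)).div 2).pd1, hB.symm hU hy]
    ring
  have m00 : Mom 0 (fun y => defoOp u y 0 0) x = (Mom 0 (pd 0 A) x + Mom 0 (pd 0 A) x) / 2 := by
    rw [e00, Mom_div, Mom_add hs hA0 hA0 0 hx]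
  have m01 : Mom 0 (fun y => defoOp u y 0 1) x = (Mom 0 (pd 1 A) x + Mom 0 (pd 0 B) x) / 2 := by
    rw [e01, Mom_div, Mom_add hs hA1 hB0 0 hx]
  have m10 : Mom 0 (fun y => defoOp u y 1 0) x = (Mom 0 (pd 0 B) x + Mom 0 (pd 1 A) x) / 2 := by
    rw [e10, Mom_div, Mom_add hs hB0 hA1 0 hx]
  have m11 : Mom 0 (fun y => defoOp u y 1 1) x = (Mom 0 (pd 1 B) x + Mom 0 (pd 1 B) x) / 2 := by
    rw [e11, Mom_div, Mom_add hs hB1 hB1 0 hx]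
  have mω : Mom 0 ω x = (Mom 0 (pd 0 B) x - Mom 0 (pd 1 A) x) / 2 := by
    rw [hωd, Mom_div, Mom_sub hs hB0 hA1 0 hx]
  have E0 := euler hU hs hω 0 hx
  have E1 := euler hU hs hω 1 hx
  have EA := euler hU hs hA 0 hx
  have EB := euler hU hs hB 0 hx
  have ω0 : ω 0 = (pd 0 B 0 - pd 1 A 0) / 2 := rfl
  have uA : ∀ y, u y 0 = A y := fun y => congrFun eA y
  have uB : ∀ y, u y 1 = B y := fun y => congrFun eB y
  rw [eA, eB, ← ω0]
  norm_num at E0 E1 EA EB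
  ext i
  rw [p1e_eq hs he (hω.pd hU 0) (hω.pd hU 1) hc0 hc1 hx i]
  fin_cases i
  · have h0 : Matrix.vecHead (u 0) = A 0 := uA 0
    simp [m00, m10, xR, uA]
    linear_combination EA - x 1 * E0 + x 1 * E1 - x 1 * mω + h0
  · have h1 : Matrix.vecHead (Matrix.vecTail (u 0)) = B 0 := uB 0
    simp [m01, m11, xR, uB]
    linear_combination EB + x 0 * E0 - x 0 * E1 + x 0 * mω + h1

lemma part3 {U : Set V2} (hU : IsOpen U) (hs : StarU U) {w : V2 → ℝ}
    (hw : Sm U w) {x : V2} (hx : x ∈ U) : svenOp (p2e w) x = w x := by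
  have hw0 := hw.pd hU 0
  have hw1 := hw.pd hU 1
  have hN : ∀ y ∈ U, p2e w y = (Mom 1 w y - Mom 2 w y) • Matrix.vecMulVec (xR y) (xR y) := by
    intro y hy
    rw [p2e, int3 hs hw hy]
  have HN : ∀ y ∈ U, HD (fun y => Mom 1 w y - Mom 2 w y) _ _ y := fun y hy =>
    (Mom_hd hU hs hw 1 hy).sub (Mom_hd hU hs hw 2 hy)
  have H0 : ∀ y ∈ U, HD (fun y => Mom 2 (pd 0 w) y - Mom 3 (pd 0 w) y) _ _ y := fun y hy =>
    (Mom_hd hU hs hw0 2 hy).sub (Mom_hd hU hs hw0 3 hy)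
  have H1 : ∀ y ∈ U, HD (fun y => Mom 2 (pd 1 w) y - Mom 3 (pd 1 w) y) _ _ y := fun y hy =>
    (Mom_hd hU hs hw1 2 hy).sub (Mom_hd hU hs hw1 3 hy)
  have f00 : ∀ y ∈ U, HD (fun y => p2e w y 0 0) _ _ y := fun y hy =>
    (((HN y hy).mul (HD.c1 y)).mul (HD.c1 y)).congr hU hy (fun z hz => by
      rw [hN z hz]; simp [xR]; ring)
  have f11 : ∀ y ∈ U, HD (fun y => p2e w y 1 1) _ _ y := fun y hy =>
    (((HN y hy).mul (HD.c0 y)).mul (HD.c0 y)).congr hU hy (fun z hz => by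
      rw [hN z hz]; simp [xR]; ring)
  have f01 : ∀ y ∈ U, HD (fun y => p2e w y 0 1) _ _ y := fun y hy =>
    (((HN y hy).mul (HD.c0 y)).mul (HD.c1 y)).neg.congr hU hy (fun z hz => by
      rw [hN z hz]; simp [xR]; ring)
  have f10 : ∀ y ∈ U, HD (fun y => p2e w y 1 0) _ _ y := fun y hy =>
    (((HN y hy).mul (HD.c0 y)).mul (HD.c1 y)).neg.congr hU hy (fun z hz => by
      rw [hN z hz]; simp [xR]; ring)
  have g00 : HD (pd 1 (fun y => p2e w y 0 0)) _ _ x :=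
    ((((H1 x hx).mul (HD.c1 x)).mul (HD.c1 x)).add
      ((HD.const 2 x).mul ((HN x hx).mul (HD.c1 x)))).congr hU hx (fun z hz => by
      rw [(f00 z hz).pd1]; ring)
  have g11 : HD (pd 0 (fun y => p2e w y 1 1)) _ _ x :=
    ((((H0 x hx).mul (HD.c0 x)).mul (HD.c0 x)).add
      ((HD.const 2 x).mul ((HN x hx).mul (HD.c0 x)))).congr hU hx (fun z hz => by
      rw [(f11 z hz).pd0]; ring)
  have g10 : HD (pd 1 (fun y => p2e w y 1 0)) _ _ x :=
    ((((H1 x hx).mul (HD.c0 x)).mul (HD.c1 x)).add ((HN x hx).mul (HD.c0 x))).neg.congr hU hx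
      (fun z hz => by rw [(f10 z hz).pd1]; ring)
  have g01 : HD (pd 0 (fun y => p2e w y 0 1)) _ _ x :=
    ((((H0 x hx).mul (HD.c0 x)).mul (HD.c1 x)).add ((HN x hx).mul (HD.c1 x))).neg.congr hU hx
      (fun z hz => by rw [(f01 z hz).pd0]; ring)
  unfold svenOp
  rw [g00.pd1, g11.pd0, g10.pd0, g01.pd1]
  have E1 := euler hU hs hw 1 hx
  have E2 := euler hU hs hw 2 hx
  have E3 := euler hU hs hw 3 hx
  have E03 := euler hU hs hw0 3 hx
  have E04 := euler hU hs hw0 4 hx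
  have E13 := euler hU hs hw1 3 hx
  have E14 := euler hU hs hw1 4 hx
  norm_num at E1 E2 E3 E03 E04 E13 E14
  norm_num
  linear_combination 4 * E2 - 4 * E3 + x 0 * (E03 - E04) + x 1 * (E13 - E14) - E2 + 2 * E3

lemma part2 {U : Set V2} (hU : IsOpen U) (hs : StarU U) {v : V2 → M2} {a b d : V2 → ℝ}
    (e00 : (fun y => v y 0 0) = a) (e01 : (fun y => v y 0 1) = b)
    (e10 : (fun y => v y 1 0) = b) (e11 : (fun y => v y 1 1) = d)
    (ha : Sm U a) (hb : Sm U b) (hd : Sm U d) {x : V2} (hx : x ∈ U) :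
    p2e (svenOp v) x + defoOp (p1e v) x = v x := by
  have hv : ∀ i j, Sm U (fun y => v y i j) := by
    intro i j
    fin_cases i <;> fin_cases j
    · exact e00 ▸ ha
    · exact e01 ▸ hb
    · exact e10 ▸ hb
    · exact e11 ▸ hd
  have ha0 := ha.pd hU 0
  have ha1 := ha.pd hU 1
  have hb0 := hb.pd hU 0
  have hb1 := hb.pd hU 1
  have hd0 := hd.pd hU 0
  have hd1 := hd.pd hU 1
  have hc0 : Sm U (fun y => pd 0 b y - pd 1 a y) := hb0.sub ha1
  have hc1 : Sm U (fun y => pd 0 d y - pd 1 b y) := hd0.sub hb1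
  have m0 := fun n => Mom_sub hs hb0 ha1 n hx
  have m1 := fun n => Mom_sub hs hd0 hb1 n hx
  have hsv : ∀ y ∈ U, svenOp v y
      = pd 0 (fun y => pd 0 d y - pd 1 b y) y - pd 1 (fun y => pd 0 b y - pd 1 a y) y := by
    intro y hy
    rw [((hd0.hd hU hy).sub (hb1.hd hU hy)).pd0, ((hb0.hd hU hy).sub (ha1.hd hU hy)).pd1]
    simp only [svenOp, e00, e01, e10, e11]
    ring
  have hq0 : ∀ y ∈ U, matCurl v y 0 = pd 0 b y - pd 1 a y := by
    intro y hy
    simp [matCurl, e00, e01]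
  have hq1 : ∀ y ∈ U, matCurl v y 1 = pd 0 d y - pd 1 b y := by
    intro y hy
    simp [matCurl, e10, e11]
  set c0 : V2 → ℝ := fun y => pd 0 b y - pd 1 a y
  set c1 : V2 → ℝ := fun y => pd 0 d y - pd 1 b y
  have hp0 : ∀ y ∈ U, p1e v y 0 = y 0 * Mom 0 a y + y 1 * Mom 0 b y
      + (y 0 * (Mom 0 c0 y - Mom 1 c0 y) + y 1 * (Mom 0 c1 y - Mom 1 c1 y)) * (- y 1) := by
    intro y hy
    rw [p1e_eq hs hv hc0 hc1 hq0 hq1 hy 0, e00, e10]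
    simp [xR]
  have hp1 : ∀ y ∈ U, p1e v y 1 = y 0 * Mom 0 b y + y 1 * Mom 0 d y
      + (y 0 * (Mom 0 c0 y - Mom 1 c0 y) + y 1 * (Mom 0 c1 y - Mom 1 c1 y)) * (y 0) := by
    intro y hy
    rw [p1e_eq hs hv hc0 hc1 hq0 hq1 hy 1, e01, e11]
    simp [xR]
  have X0 := HD.c0 x
  have X1 := HD.c1 x
  have Q := (X0.mul ((Mom_hd hU hs hc0 0 hx).sub (Mom_hd hU hs hc0 1 hx))).add
    (X1.mul ((Mom_hd hU hs hc1 0 hx).sub (Mom_hd hU hs hc1 1 hx)))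
  have P0 : HD (fun y => p1e v y 0) _ _ x :=
    (((X0.mul (Mom_hd hU hs ha 0 hx)).add (X1.mul (Mom_hd hU hs hb 0 hx))).add
      (Q.mul X1.neg)).congr hU hx hp0
  have P1 : HD (fun y => p1e v y 1) _ _ x :=
    (((X0.mul (Mom_hd hU hs hb 0 hx)).add (X1.mul (Mom_hd hU hs hd 0 hx))).add
      (Q.mul X0)).congr hU hx hp1
  have hsS : Sm U (fun y => pd 0 c1 y - pd 1 c0 y) := (hc1.pd hU 0).sub (hc0.pd hU 1)
  have hp2 : p2e (svenOp v) x
      = ((Mom 1 (pd 0 c1) x - Mom 1 (pd 1 c0) x) - (Mom 2 (pd 0 c1) x - Mom 2 (pd 1 c0) x))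
        • Matrix.vecMulVec (xR x) (xR x) := by
    rw [← Mom_sub hs (hc1.pd hU 0) (hc0.pd hU 1) 1 hx, ← Mom_sub hs (hc1.pd hU 0) (hc0.pd hU 1) 2 hx,
      ← int3 hs hsS hx, p2e]
    congr 1
    apply intervalIntegral.integral_congr
    intro t ht
    rw [Set.uIcc_of_le zero_le_one] at ht
    simp only [hsv _ (hs x hx t ht)]
  have C01 := euler hU hs hc0 1 hx
  have C02 := euler hU hs hc0 2 hx
  have C11 := euler hU hs hc1 1 hx
  have C12 := euler hU hs hc1 2 hx
  have Ea := euler hU hs ha 1 hx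
  have Eb := euler hU hs hb 1 hx
  have Ed := euler hU hs hd 1 hx
  have m01 : Mom 1 c0 x = _ := m0 1
  have m11 : Mom 1 c1 x = _ := m1 1
  norm_num at C01 C02 C11 C12 Ea Eb Ed
  have va : v x 0 0 = a x := congrFun e00 x
  have vb : v x 0 1 = b x := congrFun e01 x
  have vb' : v x 1 0 = b x := congrFun e10 x
  have vd : v x 1 1 = d x := congrFun e11 x
  rw [hp2]
  ext i j
  fin_cases i <;> fin_cases j
  · simp [defoOp, P0.pd0, va, xR]
    linear_combination Ea - x 1 * (C01 - C02) - x 1 * m01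
  · simp [defoOp, P0.pd1, P1.pd0, vb, xR]
    linear_combination Eb + (x 0 / 2) * (C01 - C02) - (x 1 / 2) * (C11 - C12)
      + (x 0 / 2) * m01 - (x 1 / 2) * m11
  · simp [defoOp, P0.pd1, P1.pd0, vb', xR]
    linear_combination Eb + (x 0 / 2) * (C01 - C02) - (x 1 / 2) * (C11 - C12)
      + (x 0 / 2) * m01 - (x 1 / 2) * m11
  · simp [defoOp, P1.pd1, vd, xR]
    linear_combination Ed + x 0 * (C11 - C12) + x 0 * m11

/-- Null-homotopy identities for the Poincaré operators of the
2D strain elasticity complex, on a domain star-shaped with respect to `0`: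
`p₁(def u) = u − j(u)` with the rigid motion
`j(u)(x) = u(0) + (1/2)(curl uᵀ)(0) • x^R`; `p₂(sven v) + def(p₁ v) = v` for
symmetric `v`; and `sven(p₂ w) = w`. -/
theorem stmt_11 (U : Set V2) (hU : IsOpen U) (h0 : (0 : V2) ∈ U)
    (hstar : ∀ x ∈ U, ∀ t ∈ Set.Icc (0:ℝ) 1, t • x ∈ U)
    (u : V2 → V2) (hu : ContDiffOn ℝ (⊤ : ℕ∞) u U)
    (v : V2 → M2) (hv : ∀ i j : Fin 2, ContDiffOn ℝ (⊤ : ℕ∞) (fun x => v x i j) U)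
    (hvsym : ∀ x, (v x).transpose = v x)
    (w : V2 → ℝ) (hw : ContDiffOn ℝ (⊤ : ℕ∞) w U) :
    (∀ x ∈ U, p1e (defoOp u) x
      = u x - (u 0 + ((pd 0 (fun y => u y 1) 0 - pd 1 (fun y => u y 0) 0) / 2) • xR x))
    ∧ (∀ x ∈ U, p2e (svenOp v) x + defoOp (p1e v) x = v x)
    ∧ (∀ x ∈ U, svenOp (p2e w) x = w x) := by
  have hs : StarU U := hstar
  have hu' : ∀ i, Sm U (fun y => u y i) := fun i => contDiffOn_pi.1 hu i
  refine ⟨fun x hx => part1 hU hs rfl rfl (hu' 0) (hu' 1) hx, fun x hx => ?_,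
    fun x hx => part3 hU hs hw hx⟩
  refine part2 hU hs rfl rfl ?_ rfl (hv 0 0) (hv 0 1) (hv 1 1) hx
  funext y
  exact congrFun (congrFun (hvsym y) 0) 1

end
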